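/- arXiv:1708.00620 — 2 statements merged into one kernel-verified Lean document; each statement's English description precedes it below -/
import Mathlib

section
/- If x is an ndh-number, then at least one of 2x and 3x is an ndh-number. -/
/-- A harmonic number is a positive integer of the form 2^a * 3^b. -/
def IsHarmonic (n : ℕ) : Prop := ∃ a b : ℕ, n = 2 ^ a * 3 ^ b

/-- An ndh-number is a positive integer that cannot be written as a difference
h - k of two harmonic numbers h and k. -/
def IsNdh (n : ℕ) : Prop :=
  0 < n ∧ ¬ ∃ h k : ℕ, IsHarmonic h ∧ IsHarmonic k ∧ n + k = h

namespace QuadraticAlgebra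

variable {a b : ℤ}

theorem im_dvd_re_pow_sub (z : QuadraticAlgebra ℤ a b) (k : ℕ) :
    z.im ∣ (z ^ k).re - z.re ^ k := by
  induction k with
  | zero => simp
  | succ k ih =>
    obtain ⟨u, hu⟩ := ih
    rw [pow_succ z, pow_succ z.re, re_mul]
    exact ⟨u * z.re + a * (z ^ k).im, by linear_combination z.re * hu⟩

theorem im_sq_dvd_im_pow_sub (z : QuadraticAlgebra ℤ a b) (k : ℕ) :
    z.im ^ 2 ∣ (z ^ (k + 1)).im - (k + 1) * z.re ^ k * z.im := by
  induction k with
  | zero => simp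
  | succ k ih =>
    obtain ⟨v, hv⟩ := ih
    obtain ⟨u, hu⟩ := im_dvd_re_pow_sub z (k + 1)
    rw [pow_succ z (k + 1), im_mul]
    refine ⟨u + v * z.re + b * ((k + 1) * z.re ^ k + z.im * v), ?_⟩
    push_cast
    linear_combination z.im * hu + (z.re + b * z.im) * hv

/-- An upper bound for the divisibility of the `ω`-coordinate of a power by powers of a prime `r`,
provided that raising to the `r`-th power multiplies this coordinate by `r` up to an `r`-unit. -/
theorem dvd_mul_im_of_dvd_im_pow {r : ℕ} (hr : r.Prime)
    (hpow : ∀ z : QuadraticAlgebra ℤ a b, (r : ℤ) ∣ z.im → ¬ (r : ℤ) ∣ z.re →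
      ∃ u : ℤ, ¬ (r : ℤ) ∣ u ∧ (z ^ r).im = r * z.im * u)
    (j k : ℕ) (hk : 0 < k) (z : QuadraticAlgebra ℤ a b) (him : (r : ℤ) ∣ z.im)
    (hre : ¬ (r : ℤ) ∣ z.re) (h : (r : ℤ) ^ j ∣ (z ^ k).im) : (r : ℤ) ^ j ∣ k * z.im := by
  have hr' : Prime (r : ℤ) := Nat.prime_iff_prime_int.mp hr
  induction k using Nat.strong_induction_on generalizing z with
  | _ k ih =>
    by_cases hrk : r ∣ k
    · obtain ⟨l, rfl⟩ := hrk
      have hl : 0 < l := Nat.pos_of_mul_pos_left hk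
      obtain ⟨u, hu, hzu⟩ := hpow z him hre
      have hre' : ¬ (r : ℤ) ∣ (z ^ r).re := fun hd =>
        hre (hr'.dvd_of_dvd_pow ((dvd_sub_right hd).mp (him.trans (im_dvd_re_pow_sub z r))))
      have hl' := ih l (lt_mul_left hl hr.one_lt) hl (z ^ r)
        (hzu ▸ dvd_mul_of_dvd_left (dvd_mul_right _ _) _) hre' (by rwa [← pow_mul])
      have hcop : IsCoprime ((r : ℤ) ^ j) u := ((hr'.coprime_iff_not_dvd).mpr hu).pow_left
      refine hcop.dvd_of_dvd_mul_right ?_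
      have heq : ((r * l : ℕ) : ℤ) * z.im * u = l * (r * z.im * u) := by
        push_cast
        ring
      rwa [heq, ← hzu]
    · obtain ⟨k, rfl⟩ := Nat.exists_eq_add_one.mpr hk
      obtain ⟨v, hv⟩ := im_sq_dvd_im_pow_sub z k
      have hu : ¬ (r : ℤ) ∣ (k + 1) * z.re ^ k + z.im * v := fun hd => by
        rcases hr'.dvd_or_dvd ((dvd_add_left (him.mul_right v)).mp hd) with h1 | h1
        · exact hrk (by exact_mod_cast h1)
        · exact hre (hr'.dvd_of_dvd_pow h1)
      have hcop : IsCoprime ((r : ℤ) ^ j) ((k + 1) * z.re ^ k + z.im * v) :=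
        ((hr'.coprime_iff_not_dvd).mpr hu).pow_left
      refine Dvd.dvd.mul_left (hcop.dvd_of_dvd_mul_right ?_) _
      have heq : z.im * ((k + 1) * z.re ^ k + z.im * v) = (z ^ (k + 1)).im := by
        linear_combination -hv
      rwa [heq]

theorem dvd_re_pow_and_not_dvd_im_pow {p : ℤ} (hp : Prime p) (ha : p ∣ a) (hb : ¬ p ∣ b)
    {z : QuadraticAlgebra ℤ a b} (hre : p ∣ z.re) (him : ¬ p ∣ z.im) {k : ℕ} (hk : 0 < k) :
    p ∣ (z ^ k).re ∧ ¬ p ∣ (z ^ k).im := by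
  induction k, hk using Nat.le_induction with
  | base => simpa using ⟨hre, him⟩
  | succ k _ ih =>
    rw [pow_succ, re_mul, im_mul]
    refine ⟨dvd_add (ih.1.mul_right _) ((ha.mul_right _).mul_right _), fun hd => ?_⟩
    have h1 : p ∣ b * (z ^ k).im * z.im :=
      (dvd_add_right (dvd_add (ih.1.mul_right z.im) (hre.mul_left (z ^ k).im))).mp hd
    rcases hp.dvd_or_dvd h1 with h2 | h2
    · exact (hp.dvd_or_dvd h2).elim hb ih.2
    · exact him h2

/-- Two elements of norm `p ^ k` in an imaginary quadratic order, both divisible only by the same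
prime above `p`, have the same `ω`-coordinate up to sign. -/
theorem im_eq_or_eq_neg_of_norm_eq_prime_pow {p : ℤ} (hp : Prime p) (hb : ¬ p ∣ b)
    (hdisc : b ^ 2 + 4 * a < -4) {z w : QuadraticAlgebra ℤ a b} {k : ℕ}
    (hzre : p ∣ z.re) (hzim : ¬ p ∣ z.im) (hwre : p ∣ w.re) (hwim : ¬ p ∣ w.im)
    (hz : z.norm = p ^ k) (hw : w.norm = p ^ k) : z.im = w.im ∨ z.im = -w.im := by
  rw [norm_def] at hz hw
  have hpk : 0 < (p ^ k) ^ 2 := by have := hp.ne_zero; positivity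
  obtain ⟨y, hy⟩ : p ^ k ∣ z.im * w.re - z.re * w.im := by
    have hn : ¬ p ∣ z.im * w.re + z.re * w.im + b * z.im * w.im := fun hd => by
      have h1 : p ∣ b * z.im * w.im :=
        (dvd_add_right (dvd_add (hwre.mul_left z.im) (hzre.mul_right w.im))).mp hd
      rcases hp.dvd_or_dvd h1 with h2 | h2
      · exact (hp.dvd_or_dvd h2).elim hb hzim
      · exact hwim h2
    refine (((hp.coprime_iff_not_dvd).mpr hn).pow_left (m := k)).dvd_of_dvd_mul_right
      ⟨z.im ^ 2 - w.im ^ 2, ?_⟩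
    linear_combination z.im ^ 2 * hw - w.im ^ 2 * hz
  have hnorm : 4 * (p ^ k) ^ 2 = (2 * (z.re * w.re + b * z.re * w.im - a * z.im * w.im) +
      b * (p ^ k * y)) ^ 2 + -(b ^ 2 + 4 * a) * ((p ^ k) ^ 2 * y ^ 2) := by
    rw [← mul_pow, ← hy]
    linear_combination -4 * p ^ k * hz - 4 * (z.re * z.re + b * z.re * z.im - a * z.im * z.im) * hw
  have hy0 : y = 0 := by
    by_contra h0
    have h1 : 1 ≤ y ^ 2 := by have : 0 < y ^ 2 := by positivity
                              omega
    nlinarith [sq_nonneg (2 * (z.re * w.re + b * z.re * w.im - a * z.im * w.im) +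
      b * (p ^ k * y)), mul_le_mul_of_nonneg_left h1 hpk.le,
      mul_nonneg hpk.le (sq_nonneg y)]
  rw [hy0, mul_zero] at hy
  refine sq_eq_sq_iff_eq_or_eq_neg.mp (mul_left_cancel₀ (pow_ne_zero k hp.ne_zero) ?_)
  linear_combination w.im ^ 2 * hz - z.im ^ 2 * hw +
    (z.im * w.re + z.re * w.im + b * z.im * w.im) * hy

theorem dvd_mul_im_of_norm_eq_prime_pow {p : ℤ} (hp : Prime p) (ha : p ∣ a) (hb : ¬ p ∣ b)
    (hdisc : b ^ 2 + 4 * a < -4) {r : ℕ} (hr : r.Prime)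
    (hpow : ∀ z : QuadraticAlgebra ℤ a b, (r : ℤ) ∣ z.im → ¬ (r : ℤ) ∣ z.re →
      ∃ u : ℤ, ¬ (r : ℤ) ∣ u ∧ (z ^ r).im = r * z.im * u)
    {z w : QuadraticAlgebra ℤ a b} {d i l j : ℕ} (hi : 0 < i) (hl : 0 < l)
    (hzre : p ∣ z.re) (hzim : ¬ p ∣ z.im) (hwre : p ∣ w.re) (hwim : ¬ p ∣ w.im)
    (hz : z.norm = p ^ (d * i)) (hw : w.norm = p ^ (d * l))
    (hrim : (r : ℤ) ∣ z.im) (hrre : ¬ (r : ℤ) ∣ z.re) (hj : (r : ℤ) ^ j ∣ w.im) :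
    (r : ℤ) ^ j ∣ l * z.im := by
  refine dvd_mul_im_of_dvd_im_pow hr hpow j l hl z hrim hrre ?_
  obtain ⟨hz1, hz2⟩ := dvd_re_pow_and_not_dvd_im_pow hp ha hb hzre hzim hl
  obtain ⟨hw1, hw2⟩ := dvd_re_pow_and_not_dvd_im_pow hp ha hb hwre hwim hi
  have hwi : (r : ℤ) ^ j ∣ (w ^ i).im := by
    obtain ⟨i, rfl⟩ := Nat.exists_eq_add_one.mpr hi
    obtain ⟨v, hv⟩ := im_sq_dvd_im_pow_sub w i
    refine hj.trans ⟨(i + 1) * w.re ^ i + w.im * v, ?_⟩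
    linear_combination hv
  rcases im_eq_or_eq_neg_of_norm_eq_prime_pow hp hb hdisc (k := d * i * l) hz1 hz2 hw1 hw2
    (by rw [map_pow, hz, ← pow_mul]) (by rw [map_pow, hw, ← pow_mul, mul_right_comm]) with h | h
  · rwa [h]
  · rwa [h, dvd_neg]

theorem exists_im_sq_eq (z : QuadraticAlgebra ℤ a 2) (him : 2 ∣ z.im) (hre : ¬ 2 ∣ z.re) :
    ∃ u : ℤ, ¬ 2 ∣ u ∧ (z ^ 2).im = 2 * z.im * u := by
  refine ⟨z.re + z.im, by omega, ?_⟩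
  rw [pow_two, im_mul]
  ring

theorem exists_im_cube_eq (z : QuadraticAlgebra ℤ a b) (him : 3 ∣ z.im) (hre : ¬ 3 ∣ z.re) :
    ∃ u : ℤ, ¬ 3 ∣ u ∧ (z ^ 3).im = 3 * z.im * u := by
  obtain ⟨f, hf⟩ := him
  refine ⟨z.re ^ 2 + 3 * (z.re * b * f + (b ^ 2 + a) * f ^ 2), fun hd => ?_, ?_⟩
  · exact hre (Int.prime_three.dvd_of_dvd_pow ((dvd_add_left (dvd_mul_right _ _)).mp hd))
  · rw [pow_succ, pow_two, im_mul, re_mul, im_mul, hf]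
    ring

end QuadraticAlgebra

theorem three_dvd_one_add_mul {c : ℤ} {A g ε : ℕ} (hA : 0 < A)
    (hc : (3 : ℤ) ^ A = 2 ^ (2 * g + ε) + c) : 3 ∣ 1 + c * 2 ^ ε := by
  have h1 : (3 : ℤ) ∣ 3 ^ A * 2 ^ ε := (dvd_pow_self 3 hA.ne').mul_right _
  have h2 : (3 : ℤ) ∣ 4 ^ (g + ε) - 1 := by simpa using sub_dvd_pow_sub_pow (4 : ℤ) 1 (g + ε)
  have h3 : 1 + c * 2 ^ ε = 3 ^ A * 2 ^ ε - ((4 : ℤ) ^ (g + ε) - 1) := by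
    rw [hc, show (4 : ℤ) = 2 ^ 2 by norm_num, ← pow_mul]
    ring
  exact h3 ▸ dvd_sub h1 h2

theorem exists_norm_eq_three_pow {c : ℤ} {A g ε : ℕ} (hA : 0 < A) (hC : 0 < 2 * g + ε)
    (hc : (3 : ℤ) ^ A = 2 ^ (2 * g + ε) + c) :
    ∃ z : QuadraticAlgebra ℤ (-(1 + c * 2 ^ ε)) 2, 3 ∣ z.re ∧ ¬ 3 ∣ z.im ∧ ¬ 2 ∣ z.re ∧
      z.norm = 3 ^ (2 * A) ∧ (z.im = 2 ^ (g + 1) ∨ z.im = -2 ^ (g + 1)) := by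
  have hδ := three_dvd_one_add_mul hA hc
  have hpow : (2 : ℤ) ^ (2 * g + ε) = (2 ^ g) ^ 2 * 2 ^ ε := by ring
  have h2 : (2 : ℤ) ∣ 2 ^ (2 * g + ε) := dvd_pow_self 2 hC.ne'
  have hodd : ¬ (2 : ℤ) ∣ 3 ^ A := fun hd => by
    have := Int.prime_two.dvd_of_dvd_pow hd
    omega
  have hG : ¬ (3 : ℤ) ∣ 2 ^ (g + 1) := fun hd => by
    have := Int.prime_three.dvd_of_dvd_pow hd
    omega
  have hG2 : (2 : ℤ) ∣ 2 ^ (g + 1) := dvd_pow_self 2 g.succ_ne_zero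
  have hsq : (2 ^ (2 * g + ε) - c) ^ 2 + c * 2 ^ ε * (2 ^ (g + 1)) ^ 2 = (3 : ℤ) ^ (2 * A) := by
    rw [mul_comm 2 A, pow_mul, hc, hpow]
    ring
  have h3 : (3 : ℤ) ∣ (2 ^ (2 * g + ε) - c - 2 ^ (g + 1)) * (2 ^ (2 * g + ε) - c + 2 ^ (g + 1)) := by
    have h4 : (3 : ℤ) ∣ 3 ^ (2 * A) := dvd_pow_self 3 (by omega)
    have heq : (2 ^ (2 * g + ε) - c - 2 ^ (g + 1)) * (2 ^ (2 * g + ε) - c + 2 ^ (g + 1)) =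
        (3 : ℤ) ^ (2 * A) - (1 + c * 2 ^ ε) * (2 ^ (g + 1)) ^ 2 := by
      rw [← hsq]
      ring
    exact heq ▸ dvd_sub h4 (hδ.mul_right _)
  rcases Int.prime_three.dvd_or_dvd h3 with h | h
  · refine ⟨⟨2 ^ (2 * g + ε) - c - 2 ^ (g + 1), 2 ^ (g + 1)⟩, h, hG, ?_, ?_, Or.inl rfl⟩
    · dsimp only; omega
    · rw [QuadraticAlgebra.norm_def, ← hsq]; ring
  · refine ⟨⟨2 ^ (2 * g + ε) - c + 2 ^ (g + 1), -2 ^ (g + 1)⟩, h, ?_, ?_, ?_, Or.inr rfl⟩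
    · rwa [dvd_neg]
    · dsimp only; omega
    · rw [QuadraticAlgebra.norm_def, ← hsq]; ring

theorem two_pow_dvd_of_pow_add_pow_eq {A C n M : ℕ} (hA : 0 < A) (hC : 0 < C) (hlt : 2 ^ C < 3 ^ A)
    (h : 3 ^ (A + n) + 2 ^ C = 2 ^ (C + 2 * M) + 3 ^ A) : 2 ^ M ∣ A + n := by
  obtain ⟨c, hc⟩ : ∃ c : ℤ, (3 : ℤ) ^ A = 2 ^ (2 * 0 + C) + c := ⟨3 ^ A - 2 ^ C, by simp⟩
  have hcB : (3 : ℤ) ^ (A + n) = 2 ^ (2 * M + C) + c := by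
    have h' : (3 : ℤ) ^ (A + n) + 2 ^ C = 2 ^ (C + 2 * M) + 3 ^ A := by exact_mod_cast h
    rw [mul_zero, zero_add] at hc
    rw [add_comm (2 * M) C]
    linarith
  have hc0 : 0 < c := by
    have h' : (2 : ℤ) ^ C < 3 ^ A := by exact_mod_cast hlt
    rw [mul_zero, zero_add] at hc
    linarith
  have hdisc : (2 : ℤ) ^ 2 + 4 * -(1 + c * 2 ^ C) < -4 := by
    have h1 : (2 : ℤ) ^ 1 ≤ 2 ^ C := pow_le_pow_right₀ (by norm_num) hC
    nlinarith
  obtain ⟨z, hz1, hz2, hz3, hz4, hz5⟩ := exists_norm_eq_three_pow hA (by omega) hc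
  obtain ⟨w, hw1, hw2, -, hw4, hw5⟩ := exists_norm_eq_three_pow (by omega) (by omega) hcB
  have hwd : ((2 : ℕ) : ℤ) ^ (M + 1) ∣ w.im := by
    rcases hw5 with h1 | h1 <;> simp [h1]
  have hzd : ((2 : ℕ) : ℤ) ∣ z.im := by
    rcases hz5 with h1 | h1 <;> simp [h1]
  have key := QuadraticAlgebra.dvd_mul_im_of_norm_eq_prime_pow Int.prime_three
    (dvd_neg.mpr (three_dvd_one_add_mul hA hc)) (by norm_num) hdisc Nat.prime_two
    QuadraticAlgebra.exists_im_sq_eq hA (by omega) hz1 hz2 hw1 hw2 hz4 hw4 hzd hz3 hwd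
  have key' : (2 : ℤ) ^ M * 2 ∣ ((A + n : ℕ) : ℤ) * 2 := by
    rw [← pow_succ]
    rcases hz5 with h1 | h1 <;> rw [h1] at key <;> simpa using key
  exact_mod_cast Int.dvd_of_mul_dvd_mul_right (by norm_num) key'

theorem exists_norm_eq_two_pow {c : ℤ} {A C g ε : ℕ} (hA : A = 2 * g + ε) (hg : 0 < g)
    (hC : 2 < C) (hc : (2 : ℤ) ^ C = 3 ^ A + c) {q : ℤ} (hq : 1 + c * 3 ^ ε = 8 * q) :
    ∃ z : QuadraticAlgebra ℤ (-(2 * q)) 1, 2 ∣ z.re ∧ ¬ 2 ∣ z.im ∧ ¬ 3 ∣ z.re ∧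
      z.norm = 2 ^ (2 * (C - 2)) ∧ (z.im = 3 ^ g ∨ z.im = -3 ^ g) := by
  obtain ⟨C, rfl⟩ : ∃ k, C = k + 2 := ⟨C - 2, by omega⟩
  have hodd (k : ℕ) : ¬ (2 : ℤ) ∣ 3 ^ k := fun hd => by
    have := Int.prime_two.dvd_of_dvd_pow hd
    omega
  have h3 : ¬ (3 : ℤ) ∣ 2 ^ (C + 1) := fun hd => by
    have := Int.prime_three.dvd_of_dvd_pow hd
    omega
  have hA3 : (3 : ℤ) ∣ 3 ^ A := dvd_pow_self 3 (by omega)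
  have hg3 : (3 : ℤ) ∣ 3 ^ g := dvd_pow_self 3 hg.ne'
  have h2 : (2 : ℤ) ∣ 2 ^ (C + 1) := dvd_pow_self 2 (by omega)
  have hoA := hodd A
  have hog := hodd g
  have hpow : (3 : ℤ) ^ A = (3 ^ g) ^ 2 * 3 ^ ε := by rw [hA]; ring
  have hsq : (3 ^ A - 2 ^ (C + 1)) ^ 2 + c * 3 ^ ε * (3 ^ g) ^ 2 = 4 * (2 : ℤ) ^ (2 * C) := by
    have hc' : c = 4 * 2 ^ C - 3 ^ A := by linear_combination -hc
    rw [hc', hpow]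
    ring
  have main : ∀ f : ℤ, (f = 3 ^ g ∨ f = -3 ^ g) → 4 ∣ 3 ^ A - 2 ^ (C + 1) - f →
      ∃ z : QuadraticAlgebra ℤ (-(2 * q)) 1, 2 ∣ z.re ∧ ¬ 2 ∣ z.im ∧ ¬ 3 ∣ z.re ∧
      z.norm = 2 ^ (2 * C) ∧ (z.im = 3 ^ g ∨ z.im = -3 ^ g) := by
    rintro f hf ⟨k, hk⟩
    refine ⟨⟨2 * k, f⟩, dvd_mul_right _ _, ?_, ?_, ?_, hf⟩
    · dsimp only; omega
    · dsimp only; omega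
    · have hf2 : f ^ 2 = (3 ^ g) ^ 2 := sq_eq_sq_iff_eq_or_eq_neg.mpr hf
      have he : (3 : ℤ) ^ A - 2 ^ (C + 1) = 4 * k + f := by linear_combination hk
      rw [he, ← hf2] at hsq
      rw [QuadraticAlgebra.norm_def]
      dsimp only
      refine mul_left_cancel₀ (four_ne_zero (α := ℤ)) ?_
      linear_combination hsq - f ^ 2 * hq
  by_cases h4 : (4 : ℤ) ∣ 3 ^ A - 2 ^ (C + 1) - 3 ^ g
  · exact main _ (Or.inl rfl) h4
  · exact main _ (Or.inr rfl) (by omega)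

theorem three_pow_dvd_of_pow_add_pow_eq {A C N m : ℕ} (hA : 2 ≤ A) (hlt : 3 ^ A < 2 ^ C)
    (h : 2 ^ (C + m) + 3 ^ A = 3 ^ (A + 2 * N) + 2 ^ C) : 3 ^ N ∣ C + m - 2 := by
  obtain ⟨ε, rfl⟩ : ∃ ε, A = 2 * 1 + ε := ⟨A - 2, by omega⟩
  have hC : 3 < C := by
    by_contra! h3
    have h1 : 2 ^ C ≤ 2 ^ 3 := Nat.pow_le_pow_right (by norm_num) h3
    have h2 : 3 ^ 2 ≤ 3 ^ (2 * 1 + ε) := Nat.pow_le_pow_right (by norm_num) hA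
    omega
  obtain ⟨c, hc⟩ : ∃ c : ℤ, (2 : ℤ) ^ C = 3 ^ (2 * 1 + ε) + c := ⟨2 ^ C - 3 ^ (2 * 1 + ε), by ring⟩
  have hcB : (2 : ℤ) ^ (C + m) = 3 ^ (2 * (N + 1) + ε) + c := by
    have h' : (2 : ℤ) ^ (C + m) + 3 ^ (2 * 1 + ε) = 3 ^ (2 * 1 + ε + 2 * N) + 2 ^ C := by
      exact_mod_cast h
    rw [show 2 * (N + 1) + ε = 2 * 1 + ε + 2 * N by ring]
    linarith
  have hc0 : 0 < c := by
    have h' : (3 : ℤ) ^ (2 * 1 + ε) < 2 ^ C := by exact_mod_cast hlt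
    linarith
  obtain ⟨q, hq⟩ : (8 : ℤ) ∣ 1 + c * 3 ^ ε := by
    have h1 : (8 : ℤ) ∣ 2 ^ C * 3 ^ ε :=
      (pow_dvd_pow (2 : ℤ) (show 3 ≤ C by omega)).mul_right _
    have h2 : (8 : ℤ) ∣ 9 ^ (1 + ε) - 1 := by simpa using sub_dvd_pow_sub_pow (9 : ℤ) 1 (1 + ε)
    have h3 : 1 + c * 3 ^ ε = 2 ^ C * 3 ^ ε - ((9 : ℤ) ^ (1 + ε) - 1) := by
      rw [hc, show (9 : ℤ) = 3 ^ 2 by norm_num, ← pow_mul]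
      ring
    exact h3 ▸ dvd_sub h1 h2
  have hdisc : (1 : ℤ) ^ 2 + 4 * -(2 * q) < -4 := by
    have h1 : 0 < c * 3 ^ ε := by positivity
    omega
  obtain ⟨z, hz1, hz2, hz3, hz4, hz5⟩ :=
    exists_norm_eq_two_pow rfl one_pos (by omega) hc hq
  obtain ⟨w, hw1, hw2, -, hw4, hw5⟩ :=
    exists_norm_eq_two_pow rfl N.succ_pos (by omega) hcB hq
  have hwd : ((3 : ℕ) : ℤ) ^ (N + 1) ∣ w.im := by
    rcases hw5 with h1 | h1 <;> simp [h1]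
  have hzd : ((3 : ℕ) : ℤ) ∣ z.im := by
    rcases hz5 with h1 | h1 <;> simp [h1]
  have key := QuadraticAlgebra.dvd_mul_im_of_norm_eq_prime_pow Int.prime_two
    (dvd_neg.mpr (dvd_mul_right 2 q)) (by norm_num) hdisc Nat.prime_three
    QuadraticAlgebra.exists_im_cube_eq (by omega) (by omega) hz1 hz2 hw1 hw2 hz4 hw4 hzd hz3 hwd
  have key' : (3 : ℤ) ^ N * 3 ∣ ((C + m - 2 : ℕ) : ℤ) * 3 := by
    rw [← pow_succ]
    rcases hz5 with h1 | h1 <;> rw [h1] at key <;> simpa using key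
  exact_mod_cast Int.dvd_of_mul_dvd_mul_right (by norm_num) key'

theorem pow_mod_eq_pow_mod_mod {b d K : ℕ} (h : b ^ d ≡ 1 [MOD K]) (n : ℕ) :
    b ^ n % K = b ^ (n % d) % K := by
  have h1 := (h.pow (n / d)).mul_right (b ^ (n % d))
  rwa [← pow_mul, ← pow_add, Nat.div_add_mod, one_pow, one_mul] at h1

theorem dvd_pow_sub_one_of_modEq_one {b d K n : ℕ} (hb : 0 < b) (h : b ^ d ≡ 1 [MOD K]) (hn : d ∣ n) :
    K ∣ b ^ n - 1 := by
  obtain ⟨l, rfl⟩ := hn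
  have h1 : b ^ (d * l) ≡ 1 [MOD K] := by simpa [pow_mul] using h.pow l
  exact (Nat.modEq_iff_dvd' (Nat.one_le_pow _ _ hb)).mp h1.symm

theorem dvd_of_dvd_pow_sub_one {b d K n : ℕ} (hb : 0 < b) (hd : 0 < d) (h : b ^ d ≡ 1 [MOD K])
    (hmin : ∀ i < d, b ^ i % K = 1 % K → i = 0) (hn : K ∣ b ^ n - 1) : d ∣ n := by
  have h1 : b ^ n ≡ 1 [MOD K] := ((Nat.modEq_iff_dvd' (Nat.one_le_pow _ _ hb)).mpr hn).symm
  exact Nat.dvd_of_mod_eq_zero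
    (hmin _ (Nat.mod_lt _ hd) ((pow_mod_eq_pow_mod_mod h n).symm.trans h1))

theorem not_three_mul_pow_add_eight_eq {n k : ℕ} : 3 * 3 ^ n + 5 ≠ 64 * 2 ^ k := fun h => by
  have h1 : ∀ i < 16, ∀ j < 8, (3 * (3 ^ i % 1088) + 5) % 1088 ≠ 64 * (2 ^ j % 17) := by
    decide +kernel
  have h2 : 64 * 2 ^ k % 1088 = 64 * (2 ^ k % 17) := Nat.mul_mod_mul_left 64 (2 ^ k) 17
  apply h1 (n % 16) (Nat.mod_lt _ (by norm_num)) (k % 8) (Nat.mod_lt _ (by norm_num))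
  rw [← pow_mod_eq_pow_mod_mod (by decide) n, ← pow_mod_eq_pow_mod_mod (by decide) k, ← h2, ← h]
  omega

theorem not_three_mul_pow_add_thirteen_eq {n k : ℕ} : 3 * 3 ^ n + 13 ≠ 512 * 2 ^ k := fun h => by
  have h1 : ∀ i < 256, ∀ j < 16,
      (3 * (3 ^ i % 131584) + 13) % 131584 ≠ 512 * (2 ^ j % 257) := by
    decide +kernel
  have h2 : 512 * 2 ^ k % 131584 = 512 * (2 ^ k % 257) := Nat.mul_mod_mul_left 512 (2 ^ k) 257
  apply h1 (n % 256) (Nat.mod_lt _ (by norm_num)) (k % 16) (Nat.mod_lt _ (by norm_num))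
  rw [← pow_mod_eq_pow_mod_mod (by decide) n, ← pow_mod_eq_pow_mod_mod (by decide) k, ← h2, ← h]
  omega

theorem not_eight_dvd_of_three_mul_eq {C n m : ℕ} (hn : 0 < n)
    (h : 3 * (3 ^ n - 1) = 2 ^ C * (2 ^ m - 1)) : ¬ 8 ∣ n := fun h8 => by
  have to2 (K : ℕ) (hK : K.Coprime 2) (hd : K ∣ 3 ^ n - 1) : K ∣ 2 ^ m - 1 :=
    (hK.pow_right C).dvd_of_dvd_mul_left (h ▸ hd.mul_left 3)
  have to3 (K : ℕ) (hK : K.Coprime 3) (hd : K ∣ 2 ^ m - 1) : K ∣ 3 ^ n - 1 :=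
    hK.dvd_of_dvd_mul_left (h ▸ hd.mul_left (2 ^ C))
  have h20 : 20 ∣ m := dvd_of_dvd_pow_sub_one (K := 41) (by norm_num) (by norm_num) (by decide)
    (by decide) (to2 41 (by decide) (dvd_pow_sub_one_of_modEq_one (by norm_num) (by decide) h8))
  have h30 : 30 ∣ n := dvd_of_dvd_pow_sub_one (K := 31) (by norm_num) (by norm_num) (by decide)
    (by decide) (to3 31 (by decide) (dvd_pow_sub_one_of_modEq_one (d := 5) (by norm_num) (by decide)
      ((by norm_num : 5 ∣ 20).trans h20)))
  have h12 : 12 ∣ m := dvd_of_dvd_pow_sub_one (K := 13) (by norm_num) (by norm_num) (by decide)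
    (by decide) (to2 13 (by decide) (dvd_pow_sub_one_of_modEq_one (d := 3) (by norm_num) (by decide)
      ((by norm_num : 3 ∣ 30).trans h30)))
  have h9 : 9 ∣ 2 ^ m - 1 := dvd_pow_sub_one_of_modEq_one (d := 12) (by norm_num) (by decide) h12
  have h9' : 9 ∣ 3 * (3 ^ n - 1) := h ▸ h9.mul_left (2 ^ C)
  have h3 : 3 ∣ 3 ^ n := dvd_pow_self 3 hn.ne'
  have h1 : 0 < 3 ^ n := by positivity
  omega

theorem eq_of_three_mul_eq {C n m : ℕ} (hC : 2 ≤ C) (hn : 0 < n) (hn2 : Even n) (hm : 0 < m)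
    (hm2 : Even m) (h : 3 * (3 ^ n - 1) = 2 ^ C * (2 ^ m - 1)) :
    C = 3 ∧ n = 2 ∧ m = 2 ∨ C = 4 ∧ n = 4 ∧ m = 4 := by
  have h8 := not_eight_dvd_of_three_mul_eq hn h
  obtain ⟨M, rfl⟩ : ∃ M, m = M + 2 := ⟨m - 2, by obtain ⟨t, rfl⟩ := hm2; omega⟩
  obtain ⟨t, ht⟩ := hn2
  have hn3 := Nat.pow_right_injective (by norm_num : 2 ≤ 3)
  have h2M : 0 < 2 ^ M := by positivity
  have h3n : 0 < 3 ^ n := by positivity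
  have hmod16 := pow_mod_eq_pow_mod_mod (b := 3) (d := 4) (K := 16) (by decide) n
  have hmod32 := pow_mod_eq_pow_mod_mod (b := 3) (d := 8) (K := 32) (by decide) n
  have hC5 : ∀ e, e ≤ C → 2 ^ e ∣ 3 * (3 ^ n - 1) := fun e he =>
    h ▸ (pow_dvd_pow 2 he).mul_right _
  rw [pow_add] at h
  have hcase : n % 8 = 4 ∨ n % 4 = 2 := by omega
  rcases hcase with h4 | h4
  · rw [h4] at hmod32
    have hC4 : C < 5 := by
      by_contra! hc
      have := hC5 5 hc
      omega
    have hC3 : C = 4 := by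
      interval_cases C <;> omega
    subst hC3
    right
    by_cases hM : 3 ≤ M
    · obtain ⟨k, rfl⟩ := Nat.exists_eq_add_of_le hM
      rw [pow_add] at h
      exact absurd (by omega) (not_three_mul_pow_add_thirteen_eq (n := n) (k := k))
    · have : 3 ^ 2 ∣ 3 ^ n := pow_dvd_pow 3 (by omega)
      interval_cases M
      · omega
      · omega
      · exact ⟨rfl, hn3 (show 3 ^ n = 3 ^ 4 by omega), rfl⟩
  · rw [h4] at hmod16
    have hC4 : C < 4 := by
      by_contra! hc
      have := hC5 4 hc
      omega
    have hC3 : C = 3 := by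
      interval_cases C <;> omega
    subst hC3
    left
    by_cases hM : 1 ≤ M
    · obtain ⟨k, rfl⟩ := Nat.exists_eq_add_of_le hM
      rw [pow_add] at h
      exact absurd (by omega) (not_three_mul_pow_add_eight_eq (n := n) (k := k))
    · interval_cases M
      exact ⟨rfl, hn3 (show 3 ^ n = 3 ^ 2 by omega), rfl⟩

theorem eq_of_two_pow_lt_three_pow {A C n m : ℕ} (hA : 0 < A) (hC : 0 < C) (hn : 0 < n)
    (hm : 0 < m) (hm2 : Even m) (hlt : 2 ^ C < 3 ^ A)
    (h : 3 ^ A * (3 ^ n - 1) = 2 ^ C * (2 ^ m - 1)) : A = 1 ∧ C = 1 ∧ n = 1 ∧ m = 2 := by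
  have h1m : 1 < 2 ^ m := Nat.one_lt_two_pow hm.ne'
  have h1n : 1 < 3 ^ n := Nat.one_lt_pow hn.ne' (by norm_num)
  have hnm : n < m := by
    refine (Nat.pow_lt_pow_iff_right (le_refl 2)).mp ?_
    have h1 : 2 ^ n ≤ 3 ^ n := Nat.pow_le_pow_left (by norm_num) n
    have h2 : 3 ^ n - 1 < 2 ^ m - 1 := by
      by_contra! h3
      have h4 : 2 ^ C * (2 ^ m - 1) < 3 ^ A * (3 ^ n - 1) :=
        Nat.mul_lt_mul_of_lt_of_le hlt h3 (by omega)
      omega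
    omega
  have hAm : A < m := by
    refine (Nat.pow_lt_pow_iff_right (le_refl 2)).mp ?_
    have h1 : 2 ^ A ≤ 3 ^ A := Nat.pow_le_pow_left (by norm_num) A
    have h2 : 3 ^ A ∣ 2 ^ m - 1 :=
      (Nat.Coprime.pow A C (by norm_num : Nat.Coprime 3 2)).dvd_of_dvd_mul_left (h ▸ dvd_mul_right _ _)
    have h3 := Nat.le_of_dvd (by omega) h2
    omega
  obtain ⟨M, rfl⟩ := hm2.two_dvd
  have hdvd : 2 ^ M ∣ A + n := by
    refine two_pow_dvd_of_pow_add_pow_eq hA hC hlt ?_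
    rw [Nat.mul_sub, Nat.mul_sub, ← pow_add, ← pow_add] at h
    have h1 : 3 ^ A ≤ 3 ^ (A + n) := Nat.pow_le_pow_right (by norm_num) (by omega)
    have h2 : 2 ^ C ≤ 2 ^ (C + 2 * M) := Nat.pow_le_pow_right (by norm_num) (by omega)
    omega
  have hle := Nat.le_of_dvd (by omega) hdvd
  have hM : M < 4 := by
    by_contra! h4
    have : 4 * M ≤ 2 ^ M := by
      clear * - h4
      induction M, h4 using Nat.le_induction with
      | base => norm_num
      | succ M _ ih => rw [pow_succ]; omega
    omega
  have hC8 : C < 8 := by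
    by_contra! h8
    have h1 : 2 ^ 8 ≤ 2 ^ C := Nat.pow_le_pow_right (by norm_num) h8
    have h2 : 3 ^ A ≤ 3 ^ 5 := Nat.pow_le_pow_right (by norm_num) (by omega)
    omega
  have key : ∀ (M : Fin 4) (A n : Fin 6) (C : Fin 8),
      0 < C.1 ∧ 0 < M.1 ∧ 0 < A.1 ∧ 0 < n.1 ∧ 2 ^ C.1 < 3 ^ A.1 ∧
      3 ^ A.1 * (3 ^ n.1 - 1) = 2 ^ C.1 * (2 ^ (2 * M.1) - 1) →
      A.1 = 1 ∧ C.1 = 1 ∧ n.1 = 1 ∧ M.1 = 1 := by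
    decide +kernel
  obtain ⟨h1, h2, h3, h4⟩ := key ⟨M, hM⟩ ⟨A, by omega⟩ ⟨n, by omega⟩ ⟨C, hC8⟩
    ⟨hC, Nat.pos_of_mul_pos_left hm, hA, hn, hlt, h⟩
  exact ⟨h1, h2, h3, congrArg (2 * ·) h4⟩

theorem eq_of_three_pow_lt_two_pow {A C n m : ℕ} (hA : 0 < A) (hn : 0 < n)
    (hm : 0 < m) (hm2 : Even m) (hlt : 3 ^ A < 2 ^ C)
    (h : 3 ^ A * (3 ^ n - 1) = 2 ^ C * (2 ^ m - 1)) :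
    A = 1 ∧ (C = 3 ∧ n = 2 ∧ m = 2 ∨ C = 4 ∧ n = 4 ∧ m = 4) := by
  have h1m : 1 < 2 ^ m := Nat.one_lt_two_pow hm.ne'
  have h1n : 1 < 3 ^ n := Nat.one_lt_pow hn.ne' (by norm_num)
  have hAC : A < C := (Nat.pow_lt_pow_iff_right (le_refl 2)).mp
    ((Nat.pow_le_pow_left (by norm_num) A).trans_lt hlt)
  have hdC : 2 ^ C ∣ 3 ^ n - 1 :=
    (Nat.Coprime.pow C A (by norm_num : Nat.Coprime 2 3)).dvd_of_dvd_mul_left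
      (h ▸ dvd_mul_right _ _)
  have hn2 : Even n := by
    have h4 : 2 ^ 2 ∣ 3 ^ n - 1 := (pow_dvd_pow 2 (by omega)).trans hdC
    exact even_iff_two_dvd.mpr
      (dvd_of_dvd_pow_sub_one (by norm_num) (by norm_num) (by decide) (by decide) h4)
  rcases (show A = 1 ∨ 2 ≤ A by omega) with rfl | hA2
  · exact ⟨rfl, eq_of_three_mul_eq (by omega) hn hn2 hm hm2 (by simpa using h)⟩
  exfalso
  obtain ⟨N, rfl⟩ := hn2.two_dvd
  have h34 : 3 ^ (2 * N) ≤ 2 ^ (4 * N) := by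
    rw [pow_mul, pow_mul]
    exact Nat.pow_le_pow_left (by norm_num) N
  have hCN : C < 4 * N := by
    refine (Nat.pow_lt_pow_iff_right (le_refl 2)).mp ?_
    have h3 := Nat.le_of_dvd (by omega) hdC
    omega
  have hmN : m < 4 * N := by
    refine (Nat.pow_lt_pow_iff_right (le_refl 2)).mp ?_
    have h2 : 2 ^ m - 1 < 3 ^ (2 * N) - 1 := by
      by_contra! h3
      have h4 : 3 ^ A * (3 ^ (2 * N) - 1) < 2 ^ C * (2 ^ m - 1) :=
        Nat.mul_lt_mul_of_lt_of_le hlt h3 (by omega)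
      omega
    omega
  have hdvd : 3 ^ N ∣ C + m - 2 := by
    refine three_pow_dvd_of_pow_add_pow_eq hA2 hlt ?_
    rw [Nat.mul_sub, Nat.mul_sub, ← pow_add, ← pow_add] at h
    have h1 : 3 ^ A ≤ 3 ^ (A + 2 * N) := Nat.pow_le_pow_right (by norm_num) (by omega)
    have h2 : 2 ^ C ≤ 2 ^ (C + m) := Nat.pow_le_pow_right (by norm_num) (by omega)
    omega
  have hle := Nat.le_of_dvd (by omega) hdvd
  have hN : N < 3 := by
    by_contra! h4
    have : 8 * N ≤ 3 ^ N := by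
      clear * - h4
      induction N, h4 using Nat.le_induction with
      | base => norm_num
      | succ N _ ih => rw [pow_succ]; omega
    omega
  have key : ∀ (N : Fin 3) (C A m : Fin 8), ¬ (0 < N.1 ∧ 2 ≤ A.1 ∧ 0 < m.1 ∧ 3 ^ A.1 < 2 ^ C.1 ∧
      3 ^ A.1 * (3 ^ (2 * N.1) - 1) = 2 ^ C.1 * (2 ^ m.1 - 1)) := by
    decide +kernel
  exact key ⟨N, hN⟩ ⟨C, by omega⟩ ⟨A, by omega⟩ ⟨m, by omega⟩
    ⟨Nat.pos_of_mul_pos_left hn, hA2, hm, hlt, h⟩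

theorem IsNdh.exists_two_mul_add_eq {x : ℕ} (hx : IsNdh x) (h : ¬ IsNdh (2 * x)) :
    ∃ s q : ℕ, 2 * x + 3 ^ s = 3 ^ q := by
  obtain ⟨_, _, ⟨p, q, rfl⟩, ⟨r, s, rfl⟩, heq⟩ :
      ∃ h k : ℕ, IsHarmonic h ∧ IsHarmonic k ∧ 2 * x + k = h := by
    by_contra hc
    exact h ⟨by have := hx.1; omega, hc⟩
  have hodd (k : ℕ) : ¬ 2 ∣ 3 ^ k := fun hd => by
    have := Nat.prime_two.dvd_of_dvd_pow hd
    omega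
  have hq := hodd q
  have hs := hodd s
  rcases p with - | p <;> rcases r with - | r
  · exact ⟨s, q, by simpa using heq⟩
  · rw [pow_succ', mul_assoc] at heq
    omega
  · rw [pow_succ', mul_assoc] at heq
    omega
  · rw [pow_succ', mul_assoc, pow_succ', mul_assoc] at heq
    exact absurd ⟨_, _, ⟨p, q, rfl⟩, ⟨r, s, rfl⟩, by omega⟩ hx.2

theorem IsNdh.exists_three_mul_add_eq {x : ℕ} (hx : IsNdh x) (h : ¬ IsNdh (3 * x)) :
    ∃ r p : ℕ, 3 * x + 2 ^ r = 2 ^ p := by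
  obtain ⟨_, _, ⟨p, q, rfl⟩, ⟨r, s, rfl⟩, heq⟩ :
      ∃ h k : ℕ, IsHarmonic h ∧ IsHarmonic k ∧ 3 * x + k = h := by
    by_contra hc
    exact h ⟨by have := hx.1; omega, hc⟩
  have hmod (k : ℕ) : ¬ 3 ∣ 2 ^ k := fun hd => by
    have := Nat.prime_three.dvd_of_dvd_pow hd
    omega
  have hp := hmod p
  have hr := hmod r
  rcases q with - | q <;> rcases s with - | s
  · exact ⟨r, p, by simpa using heq⟩
  · rw [pow_succ', mul_left_comm] at heq
    omega
  · rw [pow_succ', mul_left_comm] at heq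
    omega
  · rw [pow_succ' 3 q, mul_left_comm _ 3, pow_succ' 3 s, mul_left_comm _ 3] at heq
    exact absurd ⟨_, _, ⟨p, q, rfl⟩, ⟨r, s, rfl⟩, by omega⟩ hx.2

/-- If x is an ndh-number then at least one of 2x and 3x is an ndh-number. -/
theorem ndh_two_or_three_mul (x : ℕ) (hx : IsNdh x) :
    IsNdh (2 * x) ∨ IsNdh (3 * x) := by
  by_contra! hcon
  obtain ⟨s, q, h3⟩ := hx.exists_two_mul_add_eq hcon.1
  obtain ⟨r, p, h2⟩ := hx.exists_three_mul_add_eq hcon.2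
  have hx0 := hx.1
  have hsq : s < q := (Nat.pow_lt_pow_iff_right (by norm_num : 1 < 3)).mp (by omega)
  have hrp : r < p := (Nat.pow_lt_pow_iff_right (by norm_num : 1 < 2)).mp (by omega)
  obtain ⟨n, rfl⟩ := Nat.exists_eq_add_of_lt hsq
  obtain ⟨m, rfl⟩ := Nat.exists_eq_add_of_lt hrp
  have hx3 : 2 * x = 3 ^ s * (3 ^ (n + 1) - 1) := by
    rw [Nat.mul_sub, ← pow_add, ← add_assoc, ← h3]
    omega
  have hx2 : 3 * x = 2 ^ r * (2 ^ (m + 1) - 1) := by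
    rw [Nat.mul_sub, ← pow_add, ← add_assoc, ← h2]
    omega
  have h : 3 ^ (s + 1) * (3 ^ (n + 1) - 1) = 2 ^ (r + 1) * (2 ^ (m + 1) - 1) := by
    rw [pow_succ' 3 s, pow_succ' 2 r, mul_assoc, mul_assoc, ← hx3, ← hx2]
    ring
  have hm2 : Even (m + 1) := by
    have hd : 3 ∣ 2 ^ (m + 1) - 1 :=
      (Nat.Coprime.pow_right r (by norm_num : Nat.Coprime 3 2)).dvd_of_dvd_mul_left
        ⟨x, hx2.symm⟩
    exact even_iff_two_dvd.mpr
      (dvd_of_dvd_pow_sub_one (by norm_num) (by norm_num) (by decide) (by decide) hd)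
  rcases lt_trichotomy (2 ^ (r + 1)) (3 ^ (s + 1)) with hlt | heq | hlt
  · obtain ⟨hs, -, hn, -⟩ := eq_of_two_pow_lt_three_pow (by omega) (by omega) (by omega)
      (by omega) hm2 hlt h
    obtain ⟨rfl, rfl⟩ : s = 0 ∧ n = 0 := by omega
    exact hx.2 ⟨2, 1, ⟨1, 0, rfl⟩, ⟨0, 0, rfl⟩, by omega⟩
  · have h1 : 2 ∣ 3 ^ (s + 1) := heq ▸ dvd_pow_self 2 r.succ_ne_zero
    have := Nat.prime_two.dvd_of_dvd_pow h1
    omega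
  · obtain ⟨hs, ⟨-, hn, -⟩ | ⟨-, hn, -⟩⟩ := eq_of_three_pow_lt_two_pow (by omega) (by omega)
      (by omega) hm2 hlt h
    · obtain ⟨rfl, rfl⟩ : s = 0 ∧ n = 1 := by omega
      exact hx.2 ⟨8, 4, ⟨3, 0, rfl⟩, ⟨2, 0, rfl⟩, by omega⟩
    · obtain ⟨rfl, rfl⟩ : s = 0 ∧ n = 3 := by omega
      exact hx.2 ⟨64, 24, ⟨6, 0, rfl⟩, ⟨3, 1, rfl⟩, by omega⟩
end

section
/- Every prime number p that is congruent to 41 modulo 48 is an ndh-number. -/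
theorem three_pow_mod_sixteen (n : ℕ) :
    3 ^ n % 16 = 1 ∨ 3 ^ n % 16 = 3 ∨ 3 ^ n % 16 = 9 ∨ 3 ^ n % 16 = 11 := by
  induction n with
  | zero => simp
  | succ n ih => rw [pow_succ]; omega

theorem three_pow_mod_eight_of_odd {n : ℕ} (hn : Odd n) : 3 ^ n % 8 = 3 := by
  obtain ⟨k, rfl⟩ := hn
  rw [pow_succ, pow_mul, Nat.mul_mod, Nat.pow_mod]
  simp

theorem two_pow_mod_three_of_odd {n : ℕ} (hn : Odd n) : 2 ^ n % 3 = 2 := by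
  obtain ⟨k, rfl⟩ := hn
  rw [pow_succ, pow_mul, Nat.mul_mod, Nat.pow_mod]
  simp

theorem two_pow_small_or_sixteen_dvd (n : ℕ) :
    2 ^ n = 1 ∨ 2 ^ n = 2 ∨ 2 ^ n = 4 ∨ 2 ^ n = 8 ∨ 16 ∣ 2 ^ n := by
  by_cases h : 4 ≤ n
  · exact .inr (.inr (.inr (.inr (pow_dvd_pow 2 h))))
  · interval_cases n <;> simp

/-- If a prime is a difference of two squares, then it is the sum of the two bases, which are
consecutive. -/
theorem Nat.Prime.eq_succ_of_add_sq {p x y : ℕ} (hp : p.Prime) (h : p + y ^ 2 = x ^ 2) :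
    x = y + 1 := by
  have hxy : y < x := by
    have := hp.pos
    exact lt_of_pow_lt_pow_left₀ 2 (Nat.zero_le x) (by omega)
  obtain ⟨d, rfl⟩ := Nat.exists_eq_add_of_lt hxy
  have hfac : p = (d + 1) * (2 * y + d + 1) := by linarith
  rw [hfac, Nat.prime_mul_iff] at hp
  rcases hp with ⟨-, h1⟩ | ⟨-, h1⟩ <;> omega

theorem add_one_ne_two_pow_mul_three_pow {p : ℕ} (hmod : p % 16 = 9) (a b : ℕ) :
    p + 1 ≠ 2 ^ a * 3 ^ b := by
  intro h
  have h3 := three_pow_mod_sixteen b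
  match a with
  | 0 => omega
  | 1 => omega
  | a + 2 =>
    have : 4 ∣ 2 ^ (a + 2) * 3 ^ b := ⟨2 ^ a * 3 ^ b, by ring⟩
    omega

theorem add_three_pow_ne_two_pow {p : ℕ} (hmod : p % 16 = 9) (a d : ℕ) :
    p + 3 ^ d ≠ 2 ^ a := by
  intro h
  have h2 := two_pow_small_or_sixteen_dvd a
  have h3 := three_pow_mod_sixteen d
  generalize 3 ^ d = y at *
  omega

theorem Nat.Prime.add_two_pow_ne_three_pow {p : ℕ} (hp : p.Prime) (hmod : p % 48 = 41)
    (b c : ℕ) : p + 2 ^ c ≠ 3 ^ b := by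
  intro h
  have h2 := two_pow_small_or_sixteen_dvd c
  have h3 := three_pow_mod_sixteen b
  have hdvd : 3 ∣ 3 ^ b := dvd_pow_self 3 (by rintro rfl; omega)
  have hc : Even c := by
    by_contra hc
    have := two_pow_mod_three_of_odd (Nat.not_even_iff_odd.mp hc)
    omega
  have hb : Even b := by
    by_contra hb
    have := three_pow_mod_eight_of_odd (Nat.not_even_iff_odd.mp hb)
    omega
  obtain ⟨e, rfl⟩ := hc.two_dvd
  obtain ⟨f, rfl⟩ := hb.two_dvd
  rw [mul_comm 2 e, mul_comm 2 f, pow_mul, pow_mul] at h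
  have hfe := hp.eq_succ_of_add_sq h
  rw [hfe] at h
  have hpe : p = 2 * 2 ^ e + 1 := by linarith
  have := two_pow_small_or_sixteen_dvd e
  omega

/-- Every prime congruent to 41 modulo 48 is an ndh-number. -/
theorem ndh_prime_48k_41 (p : ℕ) (hp : p.Prime) (hmod : p % 48 = 41) :
    IsNdh p := by
  refine ⟨hp.pos, ?_⟩
  rintro ⟨h, k, ⟨a, b, rfl⟩, ⟨c, d, rfl⟩, heq⟩
  have hmod16 : p % 16 = 9 := by omega
  have hac : a = 0 ∨ c = 0 := by
    by_contra! hne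
    have h1 : 2 ∣ 2 ^ a * 3 ^ b := (dvd_pow_self 2 hne.1).mul_right _
    have h2 : 2 ∣ 2 ^ c * 3 ^ d := (dvd_pow_self 2 hne.2).mul_right _
    omega
  have hbd : b = 0 ∨ d = 0 := by
    by_contra! hne
    have h1 : 3 ∣ 2 ^ a * 3 ^ b := (dvd_pow_self 3 hne.1).mul_left _
    have h2 : 3 ∣ 2 ^ c * 3 ^ d := (dvd_pow_self 3 hne.2).mul_left _
    omega
  rcases hac with rfl | rfl <;> rcases hbd with rfl | rfl <;>
    simp only [pow_zero, one_mul, mul_one] at heq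
  · omega
  · exact hp.add_two_pow_ne_three_pow hmod b c heq
  · exact add_three_pow_ne_two_pow hmod16 a d heq
  · exact add_one_ne_two_pow_mul_three_pow hmod16 a b heq
end
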